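/- arXiv:1012.2018 — 2 statements merged into one kernel-verified Lean document; each statement's English description precedes it below -/
import Mathlib

section
/- Let G be a finite group and let χ be an irreducible complex character of G such that χ(x) is a root of unity for every 2-singular element x of G. Suppose a Sylow 2-subgroup of G has order 2^a with a ≥ 2. Then χ(1) is congruent to one of 1, −1, 2^{a−1}+1, or 2^{a−1}−1 modulo 2^a. -/
open CategoryTheory Module

/-- The trace of the inverse of an endomorphism of finite order of a complex vector space is the
complex conjugate of the trace of the endomorphism. -/
theorem trace_eq_conj_trace_of_mul_eq_one {V : Type*} [AddCommGroup V] [Module ℂ V]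
    [FiniteDimensional ℂ V] {f g : Module.End ℂ V} {n : ℕ} (hn : n ≠ 0) (hf : f ^ n = 1)
    (hgf : g * f = 1) :
    LinearMap.trace ℂ V g = starRingEnd ℂ (LinearMap.trace ℂ V f) := by
  have hss : f.IsSemisimple := by
    refine Module.End.isSemisimple_of_squarefree_aeval_eq_zero (p := Polynomial.X ^ n - 1) ?_
      (by simp [hf])
    exact (Polynomial.X_pow_sub_one_separable_iff.mpr (by exact_mod_cast hn)).squarefree
  have hint : DirectSum.IsInternal (fun μ : ℂ => f.eigenspace μ) :=
    DirectSum.isInternal_submodule_of_iSupIndep_of_iSup_eq_top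
      f.eigenspaces_iSupIndep hss.iSup_eigenspace_eq_top
  have hfin : {μ : ℂ | f.eigenspace μ ≠ ⊥}.Finite :=
    WellFoundedGT.finite_ne_bot_of_iSupIndep hint.submodule_iSupIndep
  have hfg : f * g = 1 := mul_eq_one_comm.mp hgf
  have hcomm : Commute f g := hfg.trans hgf.symm
  have hmf : ∀ μ : ℂ, Set.MapsTo f (f.eigenspace μ) (f.eigenspace μ) := fun μ =>
    Module.End.mapsTo_genEigenspace_of_comm (Commute.refl f) μ 1
  have hmg : ∀ μ : ℂ, Set.MapsTo g (f.eigenspace μ) (f.eigenspace μ) := fun μ =>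
    Module.End.mapsTo_genEigenspace_of_comm hcomm μ 1
  rw [LinearMap.trace_eq_sum_trace_restrict' hint hfin hmf,
    LinearMap.trace_eq_sum_trace_restrict' hint hfin hmg, map_sum]
  refine Finset.sum_congr rfl fun μ hμ => ?_
  obtain ⟨v, hv, hv0⟩ := (Submodule.ne_bot_iff _).mp (by simpa using hμ)
  have hvec : f.HasEigenvector μ v := ⟨hv, hv0⟩
  have hμn : μ ^ n = 1 := by
    have h := hvec.pow_apply n
    rw [hf, Module.End.one_apply] at h
    exact smul_left_injective ℂ hv0 (by simp [← h])
  have hμ0 : μ ≠ 0 := by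
    rintro rfl
    simp [hn] at hμn
  have hconj : starRingEnd ℂ μ = μ⁻¹ :=
    (Complex.inv_eq_conj (Complex.norm_eq_one_of_pow_eq_one hμn hn)).symm
  have hrf : f.restrict (hmf μ) = μ • LinearMap.id := by
    ext x
    exact Module.End.mem_eigenspace_iff.mp x.2
  have hrg : g.restrict (hmg μ) = μ⁻¹ • LinearMap.id := by
    ext x
    have hx : f x = μ • (x : V) := Module.End.mem_eigenspace_iff.mp x.2
    have h : μ • g x = x := by
      rw [← map_smul, ← hx]
      exact LinearMap.congr_fun hgf (x : V)
    change g x = μ⁻¹ • (x : V)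
    rw [eq_inv_smul_iff₀ hμ0, h]
  simp [hrf, hrg, hconj]

/-- Character values at inverse elements of a finite group are complex conjugate. -/
theorem FDRep.character_inv_eq_conj {G : Type} [Group G] [Finite G] (V : FDRep ℂ G) (x : G) :
    V.character x⁻¹ = starRingEnd ℂ (V.character x) :=
  trace_eq_conj_trace_of_mul_eq_one (orderOf_pos x).ne'
    (by rw [← map_pow, pow_orderOf_eq_one, map_one]) (by rw [← map_mul, inv_mul_cancel, map_one])

/-- The order of a finite group `H` divides `χ(1) ^ 2 - 1` when every nontrivial value of the
character `χ` of `H` has modulus one. -/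
theorem card_dvd_finrank_sq_sub_one {H W : Type*} [Group H] [Finite H] [AddCommGroup W]
    [Module ℂ W] [FiniteDimensional ℂ W] (ρ : Representation ℂ H W)
    (h : ∀ x : H, x ≠ 1 → ρ.character x * ρ.character x⁻¹ = 1) :
    (Nat.card H : ℤ) ∣ (finrank ℂ W : ℤ) ^ 2 - 1 := by
  classical
  have := Fintype.ofFinite H
  have hcard : (Nat.card H : ℂ) ≠ 0 := by exact_mod_cast Nat.card_pos.ne'
  have := invertibleOfNonzero hcard
  have hmain := ρ.card_inv_mul_sum_char_mul_char_eq_finrank ρ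
  rw [inv_mul_eq_iff_eq_mul₀ hcard, ← Finset.add_sum_erase _ _ (Finset.mem_univ (1 : H)),
    Finset.sum_congr rfl fun x hx => h x (Finset.ne_of_mem_erase hx)] at hmain
  simp only [inv_one, Representation.char_one, Finset.sum_const, nsmul_eq_mul, mul_one,
    Finset.card_erase_of_mem (Finset.mem_univ (1 : H)), Finset.card_univ,
    ← Nat.card_eq_fintype_card, Nat.cast_sub (Nat.card_pos (α := H)), Nat.cast_one] at hmain
  refine ⟨finrank ℂ (Representation.IntertwiningMap ρ ρ) - 1, ?_⟩
  have hmain' : (finrank ℂ W : ℤ) * finrank ℂ W + (Nat.card H - 1) =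
      Nat.card H * finrank ℂ (Representation.IntertwiningMap ρ ρ) := by exact_mod_cast hmain
  linear_combination hmain'

/-- Square roots of `1` modulo `2 ^ (b + 1)` are `1` or `-1` modulo `2 ^ b`. -/
theorem two_pow_dvd_sub_one_or_add_one {d : ℤ} {b : ℕ} (hb : b ≠ 0)
    (h : (2 : ℤ) ^ (b + 1) ∣ d ^ 2 - 1) : (2 : ℤ) ^ b ∣ d - 1 ∨ (2 : ℤ) ^ b ∣ d + 1 := by
  have hodd : Odd d := by
    have h2 : (2 : ℤ) ∣ d ^ 2 - 1 := (dvd_pow_self 2 b.succ_ne_zero).trans h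
    by_contra hd
    obtain ⟨k, rfl⟩ := Int.not_odd_iff_even.mp hd
    obtain ⟨m, hm⟩ := h2
    ring_nf at hm
    omega
  obtain ⟨k, rfl⟩ := hodd
  obtain ⟨c, rfl⟩ := Nat.exists_eq_add_one_of_ne_zero hb
  have hk : (2 : ℤ) ^ c ∣ k * (k + 1) := by
    refine Int.dvd_of_mul_dvd_mul_left (a := 4) (by norm_num) ?_
    convert h using 1 <;> ring
  have hor : (2 : ℤ) ^ c ∣ k ∨ (2 : ℤ) ^ c ∣ k + 1 := by
    by_cases h2 : (2 : ℤ) ∣ k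
    · exact Or.inl (Int.prime_two.pow_dvd_of_dvd_mul_right c (by omega) hk)
    · exact Or.inr (Int.prime_two.pow_dvd_of_dvd_mul_left c h2 hk)
  rw [pow_succ']
  exact hor.imp (fun ⟨m, hm⟩ => ⟨m, by linear_combination 2 * hm⟩)
    (fun ⟨m, hm⟩ => ⟨m, by linear_combination 2 * hm⟩)

/-- **Lemma 2.3(a)** (Navarro–Robinson), `p = 2` part. If the irreducible complex character
of `V` takes root of unity values on all `2`-singular elements of `G`, and a Sylow
`2`-subgroup of `G` has order `2 ^ a` with `a ≥ 2`, then the degree `χ(1)` is congruent to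
`1`, `-1`, `2 ^ (a - 1) + 1` or `2 ^ (a - 1) - 1` modulo `2 ^ a`. -/
theorem stmt_5 {G : Type} [Group G] [Fintype G]
    (V : FDRep ℂ G) (hV : Simple V)
    (hroot : ∀ x : G, 2 ∣ orderOf x → ∃ n : ℕ, 0 < n ∧ V.character x ^ n = 1)
    (S : Sylow 2 G) (a : ℕ) (ha : 2 ≤ a) (hS : Nat.card (S : Subgroup G) = 2 ^ a) :
    ((finrank ℂ V : ℤ) ≡ 1 [ZMOD (2 ^ a)]) ∨
      ((finrank ℂ V : ℤ) ≡ -1 [ZMOD (2 ^ a)]) ∨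
      ((finrank ℂ V : ℤ) ≡ 2 ^ (a - 1) + 1 [ZMOD (2 ^ a)]) ∨
      ((finrank ℂ V : ℤ) ≡ 2 ^ (a - 1) - 1 [ZMOD (2 ^ a)]) := by
  obtain ⟨b, rfl⟩ : ∃ b, a = b + 1 := ⟨a - 1, by omega⟩
  have hdvd : (2 : ℤ) ^ (b + 1) ∣ (finrank ℂ V : ℤ) ^ 2 - 1 := by
    have h := card_dvd_finrank_sq_sub_one (V.ρ.comp (S : Subgroup G).subtype) fun x hx => by
      obtain ⟨n, hn, hxn⟩ := hroot x <| by
        obtain ⟨k, hk⟩ := IsPGroup.iff_orderOf.mp S.isPGroup' x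
        rw [Subgroup.orderOf_coe, hk]
        refine dvd_pow_self 2 fun hk0 => hx ?_
        rwa [hk0, pow_zero, orderOf_eq_one_iff] at hk
      change V.character x * V.character (x : G)⁻¹ = 1
      rw [V.character_inv_eq_conj, Complex.mul_conj', Complex.norm_eq_one_of_pow_eq_one hxn hn.ne']
      simp
    rwa [hS, Nat.cast_pow, Nat.cast_ofNat] at h
  have hpow : (2 : ℤ) ^ (b + 1) = 2 * 2 ^ b := pow_succ' 2 b
  simp only [Int.modEq_iff_dvd, Nat.add_sub_cancel, hpow]
  rcases two_pow_dvd_sub_one_or_add_one (by omega) hdvd with ⟨c, hc⟩ | ⟨c, hc⟩ <;>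
    rcases Int.even_or_odd' c with ⟨k, rfl | rfl⟩
  · exact Or.inl ⟨-k, by linear_combination -hc⟩
  · exact Or.inr (Or.inr (Or.inl ⟨-k, by linear_combination -hc⟩))
  · exact Or.inr (Or.inl ⟨-k, by linear_combination -hc⟩)
  · exact Or.inr (Or.inr (Or.inr ⟨-k, by linear_combination -hc⟩))
end

section
/- Let G be a finite group and p a prime. Suppose G has a normal p-complement N, and a Sylow p-subgroup P of G is abelian and contains a subgroup isomorphic to C_p × C_p. Let χ be an irreducible complex character of G of degree prime to p such that χ(x) is a root of unity for every p-singular element x of G. If H is a subgroup of G and τ is an irreducible character of H with τ induced to G equal to χ, then H = G. -/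
open CategoryTheory Module

/-- An automorphism of order dividing `p` that stabilises a left coset of an invariant subgroup of order prime to `p`
fixes a point of that coset. -/
theorem MulAut.exists_apply_eq_of_mem_coset {X : Type*} [Group X] [Finite X] {p : ℕ}
    [Fact p.Prime] {f : MulAut X} (hf : f ^ p = 1) {L : Subgroup X}
    (hL : ∀ v, f v ∈ L ↔ v ∈ L) (hpL : ¬ p ∣ Nat.card L) {u : X} (hu : u⁻¹ * f u ∈ L) :
    ∃ w ∈ L, f (u * w) = u * w := by
  classical
  have hinv : ∀ v, u⁻¹ * f v ∈ L ↔ u⁻¹ * v ∈ L := by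
    intro v
    have h : u⁻¹ * f v = (u⁻¹ * f u) * f (u⁻¹ * v) := by
      rw [map_mul, map_inv]; group
    rw [h, L.mul_mem_cancel_left hu, hL]
  let σ : Equiv.Perm {v : X // u⁻¹ * v ∈ L} := (MulAut.toPerm X f).subtypePerm hinv
  have hpow : ∀ n : ℕ, ∀ v, ((σ ^ n) v : X) = (f ^ n) v := by
    intro n
    induction n with
    | zero => simp
    | succ n ih =>
      intro v
      rw [pow_succ', pow_succ', Equiv.Perm.mul_apply, MulAut.mul_apply, ← ih]
      rfl
  have hσ : σ ^ p ^ 1 = 1 := by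
    ext v
    rw [pow_one, hpow, hf]
    rfl
  let e : {v : X // u⁻¹ * v ∈ L} ≃ L :=
    (Equiv.mulLeft u⁻¹).subtypeEquiv (fun _ => Iff.rfl)
  have := Fintype.ofFinite {v : X // u⁻¹ * v ∈ L}
  have hcard : ¬ p ∣ Fintype.card {v : X // u⁻¹ * v ∈ L} := by
    rwa [← Nat.card_eq_fintype_card, Nat.card_congr e]
  obtain ⟨v, hv⟩ := Equiv.Perm.exists_fixed_point_of_prime hcard hσ
  refine ⟨u⁻¹ * v, v.2, ?_⟩
  rw [mul_inv_cancel_left]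
  exact congrArg Subtype.val hv

theorem pow_mem_of_prod_line_mem {C : Type*} [CommGroup C] {p : ℕ} [Fact p.Prime]
    (f : ZMod p × ZMod p → C) (L : Subgroup C)
    (h : ∀ s, s ≠ 0 → ∀ t, ∏ c : ZMod p, f (t + c • s) ∈ L) : f 0 ^ p ∈ L := by
  have h₁ : ∏ j : ZMod p, ∏ i : ZMod p, f (i, i * j) ∈ L := by
    refine L.prod_mem fun j _ => ?_
    simpa using h (1, j) (by simp) 0
  have h₂ : ∀ i : ZMod p, ∏ j : ZMod p, f (i, j) ∈ L := fun i => by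
    simpa using h (0, 1) (by simp) (i, 0)
  rw [Finset.prod_comm, ← Finset.mul_prod_erase _ _ (Finset.mem_univ 0)] at h₁
  have h₃ : ∏ i ∈ Finset.univ.erase (0 : ZMod p), ∏ j : ZMod p, f (i, i * j) ∈ L := by
    refine L.prod_mem fun i hi => ?_
    have hi : i ≠ 0 := by simpa using hi
    have h := (Equiv.mulLeft₀ i hi).bijective.prod_comp (fun j => f (i, j))
    simpa [← h] using h₂ i
  simpa [ZMod.card, ← Prod.zero_eq_mk] using (L.mul_mem_cancel_right h₃).1 h₁

/-- If `C_p × C_p` acts on a nilpotent group of order prime to `p`, the group is generated by the fixed points of the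
nontrivial elements. -/
theorem Subgroup.eq_top_of_isNilpotent_of_fixedPoints_le {X : Type*} [Group X] [Finite X]
    [Group.IsNilpotent X] {p : ℕ} [Fact p.Prime]
    [MulDistribMulAction (Multiplicative (ZMod p × ZMod p)) X] (hX : ¬ p ∣ Nat.card X)
    (K : Subgroup X)
    (hK : ∀ a : Multiplicative (ZMod p × ZMod p), a ≠ 1 → ∀ v : X, a • v = v → v ∈ K) :
    K = ⊤ := by
  suffices h : ∀ i, upperCentralSeries X i ≤ K by
    obtain ⟨n, hn⟩ := Group.IsNilpotent.nilpotent X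
    exact top_le_iff.1 (hn ▸ h n)
  intro i
  induction i with
  | zero => simp
  | succ i ih =>
    intro z hz
    set Z := upperCentralSeries X i
    have hmap : ∀ f : MulAut X, Z.map (f : X →* X) = Z := fun f =>
      Subgroup.characteristic_iff_map_eq.1 inferInstance f
    have hmemZ : ∀ (f : MulAut X) v, f v ∈ Z ↔ v ∈ Z := by
      intro f v
      constructor
      · intro h
        rw [← hmap f] at h
        obtain ⟨w, hw, hwv⟩ := h
        rwa [← f.injective hwv]
      · intro h
        rw [← hmap f]
        exact ⟨v, h, rfl⟩
    let φ : Multiplicative (ZMod p × ZMod p) → MulAut X := fun a =>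
      MulDistribMulAction.toMulAut _ X a
    have hcen : ∀ a : Multiplicative (ZMod p × ZMod p),
        (QuotientGroup.mk (a • z) : X ⧸ Z) ∈ Subgroup.center (X ⧸ Z) := by
      intro a
      have ha : a • z ∈ upperCentralSeries X (i + 1) := by
        rw [← (Subgroup.characteristic_iff_map_eq.1 inferInstance (φ a) :
          (upperCentralSeries X (i + 1)).map (φ a : X →* X) = _)]
        exact ⟨z, hz, rfl⟩
      rw [Subgroup.mem_center_iff]
      intro y
      induction y using QuotientGroup.induction_on with
      | H y =>
        rw [← QuotientGroup.mk_mul, ← QuotientGroup.mk_mul, QuotientGroup.eq]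
        have h := (mem_upperCentralSeries_succ_iff.1 ((inv_mem ha))) y⁻¹
        simpa [mul_assoc, commutatorElement_def] using h
    let : CommGroup (Subgroup.center (X ⧸ Z)) := IsMulCommutative.instCommGroup
    let f : ZMod p × ZMod p → Subgroup.center (X ⧸ Z) := fun s =>
      ⟨QuotientGroup.mk (Multiplicative.ofAdd s • z), hcen _⟩
    let ψ : Multiplicative (ZMod p × ZMod p) →
        (Subgroup.center (X ⧸ Z) ≃* Subgroup.center (X ⧸ Z)) := fun a =>
      Subgroup.centerCongr (QuotientGroup.congr Z Z (φ a) (hmap _))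
    have hψ : ∀ s t, ψ (Multiplicative.ofAdd s) (f t) = f (t + s) := by
      intro s t
      apply Subtype.ext
      change (QuotientGroup.mk (Multiplicative.ofAdd s • Multiplicative.ofAdd t • z) : X ⧸ Z) = _
      rw [smul_smul, ← ofAdd_add, add_comm]
    let L : Subgroup (Subgroup.center (X ⧸ Z)) :=
      (K.map (QuotientGroup.mk' Z)).comap (Subgroup.subtype _)
    have hpow : f 0 ^ p ∈ L := by
      refine pow_mem_of_prod_line_mem f L fun s hs t => ?_
      set g := ∏ c : ZMod p, f (t + c • s) with hg
      have hfix : ψ (Multiplicative.ofAdd s) g = g := by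
        rw [hg, map_prod]
        simp_rw [hψ]
        rw [← (Equiv.addRight (1 : ZMod p)).bijective.prod_comp (fun c => f (t + c • s))]
        refine Finset.prod_congr rfl fun c _ => ?_
        simp [add_smul, add_assoc]
      obtain ⟨u, hu⟩ := QuotientGroup.mk_surjective (g : X ⧸ Z)
      have hus : u⁻¹ * φ (Multiplicative.ofAdd s) u ∈ Z := by
        rw [← QuotientGroup.eq, hu, ← hfix]
        change QuotientGroup.congr Z Z (φ _) (hmap _) (g : X ⧸ Z) = _
        rw [← hu]
        rfl
      obtain ⟨w, hw, hw'⟩ := MulAut.exists_apply_eq_of_mem_coset (p := p)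
        (f := φ (Multiplicative.ofAdd s))
        (by
          simp only [φ, ← map_pow]
          rw [← ofAdd_nsmul, show p • s = 0 by ext <;> simp]
          exact map_one (MulDistribMulAction.toMulAut _ X)) (hmemZ _)
        (fun h => hX (h.trans (Subgroup.card_subgroup_dvd_card Z))) hus
      refine ⟨u * w, hK (Multiplicative.ofAdd s) (by simpa using hs) _ hw', ?_⟩
      simp only [QuotientGroup.mk'_apply, Subgroup.coe_subtype]
      rw [← hu, QuotientGroup.eq]
      simpa using hw
    obtain ⟨k, hk, hkz⟩ := hpow
    have hkz : (QuotientGroup.mk k : X ⧸ Z) = QuotientGroup.mk (z ^ p) := by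
      simpa [f] using hkz
    have hzp : z ^ p ∈ K := by
      rw [QuotientGroup.eq] at hkz
      simpa using K.mul_mem hk (ih hkz)
    obtain ⟨m, hm⟩ := exists_pow_eq_self_of_coprime (x := z) (n := p)
      (((Nat.Prime.coprime_iff_not_dvd Fact.out).2 hX).coprime_dvd_right (_root_.orderOf_dvd_natCard z))
    rw [← hm]
    exact K.pow_mem hzp m

/-- If `C_p × C_p` acts on a group of order prime to `p`, the group is generated by the fixed points of the
nontrivial elements. -/
theorem Subgroup.eq_top_of_fixedPoints_le {X : Type*} [Group X] [Finite X]
    {p : ℕ} [Fact p.Prime]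
    [MulDistribMulAction (Multiplicative (ZMod p × ZMod p)) X] (hX : ¬ p ∣ Nat.card X)
    (K : Subgroup X)
    (hK : ∀ a : Multiplicative (ZMod p × ZMod p), a ≠ 1 → ∀ v : X, a • v = v → v ∈ K) :
    K = ⊤ := by
  have hP : IsPGroup p (Multiplicative (ZMod p × ZMod p)) :=
    IsPGroup.of_card (n := 2) (by simp [sq])
  have hsyl : ∀ q : ℕ, q.Prime → ∃ R : Sylow q X, (R : Subgroup X) ≤ K := by
    intro q hq
    have : Fact q.Prime := ⟨hq⟩
    obtain ⟨R, hR⟩ := hP.nonempty_fixed_point_of_prime_not_dvd_card (Sylow q X)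
      (fun h => hX (h.trans ((Sylow.card_dvd_index default).trans (Subgroup.index_dvd_card _))))
    have hmem : ∀ a : Multiplicative (ZMod p × ZMod p), ∀ v ∈ R, a • v ∈ R := by
      intro a v hv
      have h := Subgroup.smul_mem_pointwise_smul v a (R : Subgroup X) hv
      rwa [← Sylow.pointwise_smul_def, hR a] at h
    let : MulDistribMulAction (Multiplicative (ZMod p × ZMod p)) R :=
      { smul := fun a v => ⟨a • (v : X), hmem a v v.2⟩
        one_smul := fun v => Subtype.ext (one_smul _ (v : X))
        mul_smul := fun a b v => Subtype.ext (mul_smul a b (v : X))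
        smul_mul := fun a v w => Subtype.ext (smul_mul' a (v : X) w)
        smul_one := fun a => Subtype.ext (smul_one a) }
    have : Group.IsNilpotent R := R.isPGroup'.isNilpotent
    refine ⟨R, Subgroup.subgroupOf_eq_top.1 ?_⟩
    refine Subgroup.eq_top_of_isNilpotent_of_fixedPoints_le (p := p)
      (fun h => hX (h.trans (Subgroup.card_subgroup_dvd_card _))) _ fun a ha v hv => ?_
    exact hK a ha v (congrArg Subtype.val hv)
  apply Subgroup.eq_top_of_card_eq
  refine Nat.dvd_antisymm (Subgroup.card_subgroup_dvd_card K) ?_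
  refine (Nat.dvd_iff_prime_pow_dvd_dvd _ _).2 fun q k hq hk => ?_
  have : Fact q.Prime := ⟨hq⟩
  obtain ⟨R, hR⟩ := hsyl q hq
  refine (R.pow_dvd_card_of_pow_dvd_card hk).trans (Subgroup.card_dvd_of_le hR)

theorem LinearMap.isIntegral_trace_of_pow_eq_one {V : Type*} [AddCommGroup V] [Module ℂ V]
    [FiniteDimensional ℂ V] (f : Module.End ℂ V) {n : ℕ} (hn : 0 < n) (hf : f ^ n = 1) :
    IsIntegral ℤ (LinearMap.trace ℂ V f) := by
  rw [Module.End.trace_eq_sum_roots_charpoly_of_splits (IsAlgClosed.splits _)]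
  refine IsIntegral.multiset_sum fun μ hμ => ?_
  have hμ : f.HasEigenvalue μ :=
    (Module.End.hasEigenvalue_iff_isRoot_charpoly f μ).2 (Polynomial.isRoot_of_mem_roots hμ)
  obtain ⟨v, hv⟩ := hμ.exists_hasEigenvector
  have h := hv.pow_apply n
  rw [hf] at h
  have h1 : μ ^ n = 1 := by
    have h2 : (μ ^ n - 1) • v = 0 := by rw [sub_smul, ← h]; simp
    exact sub_eq_zero.1 ((smul_eq_zero.1 h2).resolve_right hv.2)
  exact IsIntegral.of_pow hn (h1 ▸ isIntegral_one)

theorem FDRep.isIntegral_character {G : Type} [Group G] [Finite G] (V : FDRep ℂ G) (g : G) :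
    IsIntegral ℤ (V.character g) :=
  LinearMap.isIntegral_trace_of_pow_eq_one (V.ρ g) (orderOf_pos g) (by
    rw [← map_pow, pow_orderOf_eq_one, map_one])

theorem Nat.eq_one_of_mul_pow_eq_one_of_isIntegral {k n : ℕ} (hn : 0 < n) {z : ℂ}
    (hz : IsIntegral ℤ z) (h : ((k : ℂ) * z) ^ n = 1) : k = 1 := by
  rw [mul_pow] at h
  have hk : (k : ℂ) ^ n ≠ 0 := left_ne_zero_of_mul_eq_one h
  have hint : IsIntegral ℤ (algebraMap ℚ ℂ (((k : ℚ) ^ n)⁻¹)) := by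
    have : algebraMap ℚ ℂ (((k : ℚ) ^ n)⁻¹) = z ^ n := by
      rw [eq_comm]
      simpa using eq_inv_of_mul_eq_one_right h
    rw [this]
    exact hz.pow n
  rw [isIntegral_algebraMap_iff (algebraMap ℚ ℂ).injective] at hint
  obtain ⟨m, hm⟩ := IsIntegrallyClosed.isIntegral_iff.1 hint
  have hk' : (k : ℚ) ^ n ≠ 0 := by exact_mod_cast hk
  have h1 : (k : ℤ) ^ n * m = 1 := by
    have : (k : ℚ) ^ n * m = 1 := by
      rw [show (m : ℚ) = ((k : ℚ) ^ n)⁻¹ from hm, mul_inv_cancel₀ hk']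
    exact_mod_cast this
  have h2 : (k ^ n : ℕ) = 1 := by
    have := Int.isUnit_iff_natAbs_eq.1 (IsUnit.of_mul_eq_one _ h1)
    simpa [Int.natAbs_pow] using this
  exact (Nat.pow_eq_one.1 h2).resolve_right hn.ne'

theorem exists_injective_hom_of_card_eq_prime_sq {Q : Type*} [Group Q] {p : ℕ} [Fact p.Prime]
    (hcard : Nat.card Q = p ^ 2) (hexp : ∀ x : Q, x ^ p = 1) :
    ∃ e : Multiplicative (ZMod p × ZMod p) →* Q, Function.Injective e := by
  let : CommGroup Q := IsPGroup.commGroupOfCardEqPrimeSq hcard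
  let : Module (ZMod p) (Additive Q) := AddCommGroup.zmodModule (n := p) fun x => hexp x.toMul
  have : Finite Q := Nat.finite_of_card_ne_zero (hcard ▸ pow_ne_zero _ (Fact.out : p.Prime).ne_zero)
  have hfin : finrank (ZMod p) (Additive Q) = 2 := by
    have h := Module.natCard_eq_pow_finrank (K := ZMod p) (V := Additive Q)
    rw [Nat.card_zmod, show Nat.card (Additive Q) = p ^ 2 from hcard] at h
    exact (Nat.pow_right_injective (Fact.out : p.Prime).two_le h).symm
  let ℓ : (ZMod p × ZMod p) ≃ₗ[ZMod p] Additive Q :=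
    LinearEquiv.ofFinrankEq _ _ (by rw [hfin]; simp)
  exact ⟨AddMonoidHom.toMultiplicativeLeft ℓ.toAddEquiv.toAddMonoidHom, ℓ.injective⟩

open scoped Pointwise in
theorem exists_conj_eq_of_conj_mem {G : Type*} [Group G] [Finite G] {p : ℕ} [Fact p.Prime]
    {N H : Subgroup G} [N.Normal] (hN : ¬ p ∣ Nat.card N) (hNH : N ⊔ H = ⊤) {x : G} (hxH : x ∈ H)
    (hxp : x ^ p = 1) {g : G} (hg : g⁻¹ * x * g ∈ H) : ∃ k ∈ H, g⁻¹ * x * g = k * x * k⁻¹ := by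
  obtain ⟨n, hn, h, hh, rfl⟩ : g ∈ (N : Set G) * (H : Set G) := by
    rw [← Subgroup.normal_mul, hNH]
    trivial
  have hg : n⁻¹ * x * n ∈ H := by
    have := H.mul_mem (H.mul_mem hh hg) (H.inv_mem hh)
    simpa [mul_assoc] using this
  obtain ⟨w, hw, hwx⟩ := MulAut.exists_apply_eq_of_mem_coset (p := p)
    (f := (MulAut.conjNormal x : MulAut N)) (by rw [← map_pow, hxp, map_one])
    (L := H.subgroupOf N) (u := ⟨n, hn⟩)
    (fun v => by
      rw [Subgroup.mem_subgroupOf, Subgroup.mem_subgroupOf, MulAut.conjNormal_apply,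
        H.mul_mem_cancel_right (H.inv_mem hxH), H.mul_mem_cancel_left hxH])
    (fun hd => hN (hd.trans (Subgroup.card_subgroup_dvd_card _)))
    (by
      rw [Subgroup.mem_subgroupOf]
      simpa [MulAut.conjNormal_apply, mul_assoc] using H.mul_mem hg (H.inv_mem hxH))
  have hwx : x * (n * w) * x⁻¹ = n * w := congrArg Subtype.val hwx
  rw [mul_inv_eq_iff_eq_mul] at hwx
  have hwH : (w : G) ∈ H := hw
  refine ⟨h⁻¹ * w, H.mul_mem (H.inv_mem hh) hwH, ?_⟩
  have : n⁻¹ * x * n = w * x * (w : G)⁻¹ := by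
    rw [eq_mul_inv_iff_mul_eq]
    simp only [mul_assoc] at hwx ⊢
    rw [hwx, inv_mul_cancel_left]
  calc (n * h)⁻¹ * x * (n * h) = h⁻¹ * (n⁻¹ * x * n) * h := by group
    _ = _ := by rw [this]; group

open scoped Classical Pointwise in
theorem mem_of_commute_of_induced_character_root_of_unity {G : Type} [Group G] [Fintype G] {p : ℕ}
    [Fact p.Prime] {N H : Subgroup G} [N.Normal] (hN : ¬ p ∣ Nat.card N) (hNH : N ⊔ H = ⊤)
    (W : FDRep ℂ H) {x : G} (hxH : x ∈ H) (hxp : x ^ p = 1) {n : ℕ} (hn : 0 < n)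
    (hroot : ((Nat.card H : ℂ)⁻¹ *
        ∑ g : G, if h : g * x * g⁻¹ ∈ H then W.character ⟨g * x * g⁻¹, h⟩ else 0) ^ n = 1)
    {c : G} (hc : c * x = x * c) : c ∈ H := by
  set F : Set G := {g | g⁻¹ * x * g ∈ H} with hF
  have hHF : (H : Set G) ⊆ F := fun h hh => H.mul_mem (H.mul_mem (H.inv_mem hh) hxH) hh
  have hFH : F * (H : Set G) = F := by
    refine subset_antisymm ?_ (Set.subset_mul_left F H.one_mem)
    rintro _ ⟨g, hg, h, hh, rfl⟩
    have : h⁻¹ * (g⁻¹ * x * g) * h ∈ H := H.mul_mem (H.mul_mem (H.inv_mem hh) hg) hh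
    simpa [hF, mul_assoc] using this
  have hsum : (∑ g : G, if h : g * x * g⁻¹ ∈ H then W.character ⟨g * x * g⁻¹, h⟩ else 0) =
      (Nat.card F : ℂ) * W.character ⟨x, hxH⟩ := by
    rw [← (Equiv.inv G).bijective.sum_comp]
    have hterm : ∀ g : G, (if h : (Equiv.inv G g) * x * (Equiv.inv G g)⁻¹ ∈ H then
        W.character ⟨(Equiv.inv G g) * x * (Equiv.inv G g)⁻¹, h⟩ else 0) =
        if g ∈ F then W.character ⟨x, hxH⟩ else 0 := by
      intro g
      simp only [Equiv.inv_apply, inv_inv]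
      by_cases hg : g⁻¹ * x * g ∈ H
      · rw [dif_pos hg, if_pos (show g ∈ F from hg)]
        obtain ⟨k, hk, hkx⟩ := exists_conj_eq_of_conj_mem hN hNH hxH hxp hg
        rw [← W.char_conj ⟨x, hxH⟩ ⟨k, hk⟩]
        exact congrArg W.character (Subtype.ext hkx)
      · rw [dif_neg hg, if_neg (show g ∉ F from hg)]
    rw [Finset.sum_congr rfl fun g _ => hterm g, ← Finset.sum_filter, Finset.sum_const,
      nsmul_eq_mul, Nat.card_eq_fintype_card, Fintype.card_subtype]
  obtain ⟨k, hk⟩ : ∃ k, Nat.card F = Nat.card H * k :=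
    ⟨_, hFH ▸ Subgroup.card_mul_eq_card_subgroup_mul_card_quotient H F⟩
  have hH0 : (Nat.card H : ℂ) ≠ 0 := Nat.cast_ne_zero.2 Nat.card_pos.ne'
  rw [hsum, hk, Nat.cast_mul, mul_assoc, inv_mul_cancel_left₀ hH0] at hroot
  have hk1 := Nat.eq_one_of_mul_pow_eq_one_of_isIntegral hn (W.isIntegral_character _) hroot
  rw [hk1, mul_one] at hk
  have : (H : Set G) = F := Set.eq_of_subset_of_ncard_le hHF hk.le
  change c ∈ (H : Set G)
  rw [this]
  simpa [hF, mul_assoc, ← hc] using hxH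

open scoped Classical in
/-- Primitivity step in the proof of **Theorem 2.6** (Navarro–Robinson). Suppose the finite
group `G` has a normal `p`-complement `N` and an abelian Sylow `p`-subgroup `S` containing
a subgroup isomorphic to `C_p × C_p`. Let `χ` be an irreducible complex character of `G` of
degree prime to `p` taking root of unity values on all `p`-singular elements. If `χ` is
induced from an irreducible character `τ` of a subgroup `H` (via the usual induced
character formula `τ^G(g) = |H|⁻¹ ∑_{x ∈ G} τ°(x g x⁻¹)`), then `H = G`. -/
theorem stmt_14 {G : Type} [Group G] [Fintype G] (p : ℕ) (hp : p.Prime)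
    (N : Subgroup G) (S : Sylow p G)
    (hNnormal : N.Normal) (hN : ¬ p ∣ Nat.card N)
    (hsup : N ⊔ (S : Subgroup G) = ⊤) (hinf : N ⊓ (S : Subgroup G) = ⊥)
    (habelian : ∀ a b : (S : Subgroup G), a * b = b * a)
    (hCpCp : ∃ Q : Subgroup G, Q ≤ (S : Subgroup G) ∧
      Nat.card Q = p ^ 2 ∧ ∀ x : Q, x ^ p = 1)
    (V : FDRep ℂ G) (hV : Simple V) (hdeg : ¬ p ∣ finrank ℂ V)
    (hroot : ∀ x : G, p ∣ orderOf x → ∃ n : ℕ, 0 < n ∧ V.character x ^ n = 1)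
    (H : Subgroup G) (W : FDRep ℂ H) (hW : Simple W)
    (hind : ∀ g : G, V.character g =
      (Nat.card H : ℂ)⁻¹ *
        ∑ x : G, if h : x * g * x⁻¹ ∈ H then W.character ⟨x * g * x⁻¹, h⟩ else 0) :
    H = ⊤ := by
  have : Fact p.Prime := ⟨hp⟩
  have hdegree : finrank ℂ V = H.index * finrank ℂ W := by
    have h := hind 1
    have hterm : ∀ x : G, (if h : x * 1 * x⁻¹ ∈ H then W.character ⟨x * 1 * x⁻¹, h⟩ else 0) =
        (finrank ℂ W : ℂ) := by
      intro x
      have hx : x * 1 * x⁻¹ = 1 := by group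
      rw [dif_pos (hx.symm ▸ H.one_mem), ← W.char_one]
      exact congrArg W.character (Subtype.ext hx)
    rw [Finset.sum_congr rfl fun x _ => hterm x, Finset.sum_const, nsmul_eq_mul, V.char_one,
      Finset.card_univ, ← Nat.card_eq_fintype_card, ← H.card_mul_index, Nat.cast_mul, mul_assoc,
      inv_mul_cancel_left₀ (Nat.cast_ne_zero.2 Nat.card_pos.ne')] at h
    exact_mod_cast h
  have hindex : ¬ p ∣ H.index := fun h => hdeg (hdegree ▸ h.mul_right _)
  have hNH : N ⊔ H = ⊤ := by
    rw [← Subgroup.index_eq_one]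
    obtain ⟨k, hk⟩ := IsPGroup.iff_card.1 S.isPGroup'
    have hNindex : N.index ∣ p ^ k := by
      rw [← hk, ← Subgroup.relIndex_top_right, ← hsup, Subgroup.relIndex_sup_left]
      exact Subgroup.relIndex_dvd_card _ _
    exact Nat.eq_one_of_dvd_coprimes (((hp.coprime_iff_not_dvd).2 hindex).pow_left k)
      ((Subgroup.index_dvd_of_le le_sup_left).trans hNindex) (Subgroup.index_dvd_of_le le_sup_right)
  obtain ⟨Q, -, hQcard, hQexp⟩ := hCpCp
  obtain ⟨e₀, he₀⟩ := exists_injective_hom_of_card_eq_prime_sq hQcard hQexp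
  obtain ⟨y, hy⟩ := (IsPGroup.of_card hQcard).nonempty_fixed_point_of_prime_not_dvd_card
    (G ⧸ H) hindex
  obtain ⟨g, rfl⟩ := QuotientGroup.mk_surjective y
  let e : Multiplicative (ZMod p × ZMod p) →* G :=
    (MulAut.conj g⁻¹).toMonoidHom.comp (Q.subtype.comp e₀)
  have he : Function.Injective e :=
    (MulAut.conj g⁻¹).injective.comp (Subtype.val_injective.comp he₀)
  have heH : ∀ a, e a ∈ H := by
    intro a
    have h : (QuotientGroup.mk g : G ⧸ H) = QuotientGroup.mk ((e₀ a : G) * g) := (hy (e₀ a)).symm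
    rw [QuotientGroup.eq] at h
    simpa [e, mul_assoc] using h
  let : MulDistribMulAction (Multiplicative (ZMod p × ZMod p)) N :=
    MulDistribMulAction.compHom N ((MulAut.conjNormal : G →* MulAut N).comp e)
  have hNle : H.subgroupOf N = ⊤ := by
    refine Subgroup.eq_top_of_fixedPoints_le (p := p) hN _ fun a ha v hv => ?_
    have hap : a ^ p = 1 := by
      apply Multiplicative.toAdd.injective
      ext <;> simp
    have hep : e a ^ p = 1 := by rw [← map_pow, hap, map_one]
    have hord : orderOf (e a) = p :=
      orderOf_eq_prime hep fun h => ha (he (h.trans (map_one e).symm))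
    obtain ⟨n, hn, hroot⟩ := hroot (e a) hord.symm.dvd
    rw [hind] at hroot
    have hv : e a * v * (e a)⁻¹ = v := congrArg Subtype.val hv
    exact mem_of_commute_of_induced_character_root_of_unity hN hNH W (heH a) hep hn hroot
      (mul_inv_eq_iff_eq_mul.1 hv).symm
  rw [← hNH]
  exact (sup_eq_right.2 (Subgroup.subgroupOf_eq_top.1 hNle)).symm
end
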